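/- arXiv:0804.3117 — 5 statements merged into one kernel-verified Lean document; each statement's English description precedes it below -/
import Mathlib

section
/- Let A ∈ ℝ^{n×n}, B ∈ ℝ^{n×m}, C ∈ ℝ^{p×n}, D ∈ ℝ^{p×m}, and suppose (A,B) is controllable and (C,A) is observable. Then the following are equivalent: (i) A has no eigenvalue on the imaginary axis (i.e., no eigenvalue with zero real part); (ii) for every ω ∈ ℝ the matrix iωI − A (over ℂ) is invertible, and the function ω ↦ ‖C(iωI − A)⁻¹B + D‖ is bounded on ℝ. -/
open MeasureTheory Matrix Set

/-- The controllability matrix `[B, AB, ..., A^{n-1}B]`. -/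
noncomputable def ctrbMatrix {n m : ℕ} (A : Matrix (Fin n) (Fin n) ℝ)
    (B : Matrix (Fin n) (Fin m) ℝ) : Matrix (Fin n) (Fin n × Fin m) ℝ :=
  Matrix.of fun i p => (A ^ (p.1 : ℕ) * B) i p.2

/-- `(A, B)` is controllable if the controllability matrix has full rank `n`. -/
def Controllable {n m : ℕ} (A : Matrix (Fin n) (Fin n) ℝ)
    (B : Matrix (Fin n) (Fin m) ℝ) : Prop :=
  (ctrbMatrix A B).rank = n

/-- `(C, A)` is observable if `(Aᵀ, Cᵀ)` is controllable. -/
def Observable {n p : ℕ} (C : Matrix (Fin p) (Fin n) ℝ)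
    (A : Matrix (Fin n) (Fin n) ℝ) : Prop :=
  Controllable Aᵀ Cᵀ

/-- A real square matrix is Hurwitz if all of its (complex) eigenvalues, i.e. the roots of
its characteristic polynomial over `ℂ`, have strictly negative real part. -/
def IsHurwitz {n : ℕ} (A : Matrix (Fin n) (Fin n) ℝ) : Prop :=
  ∀ z : ℂ, (Matrix.charpoly (A.map (fun a => (a : ℂ)))).IsRoot z → z.re < 0


section Aux

attribute [local instance] Matrix.linftyOpNormedRing Matrix.linftyOpNormedAlgebra

theorem aux_resolvent_tendsto {n : ℕ} (A : Matrix (Fin n) (Fin n) ℂ) :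
    Filter.Tendsto (resolvent A) (Bornology.cobounded ℂ)
      (nhds (0 : Matrix (Fin n) (Fin n) ℂ)) :=
  spectrum.resolvent_tendsto_cobounded A

theorem aux_inv_continuous {n : ℕ} (f : ℝ → Matrix (Fin n) (Fin n) ℂ)
    (hf : Continuous f) (h : ∀ x, IsUnit (f x)) : Continuous (fun x => (f x)⁻¹) := by
  have h1 : (fun x => (f x)⁻¹) = fun x => (f x).det⁻¹ • (f x).adjugate := by
    funext x
    rw [Matrix.inv_def, Ring.inverse_eq_inv']
  rw [h1]
  refine Continuous.smul (hf.matrix_det.inv₀ fun x => ?_) hf.matrix_adjugate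
  exact ((Matrix.isUnit_iff_isUnit_det _).1 (h x)).ne_zero

end Aux

attribute [local instance] Matrix.normedAddCommGroup

/-- For a controllable and observable system, `A` has no purely imaginary eigenvalue iff
`iωI - A` is invertible for every real `ω` and the transfer function
`ω ↦ C (iωI - A)⁻¹ B + D` is bounded on the imaginary axis. -/
theorem statement2 {n m p : ℕ}
    (A : Matrix (Fin n) (Fin n) ℝ) (B : Matrix (Fin n) (Fin m) ℝ)
    (C : Matrix (Fin p) (Fin n) ℝ) (D : Matrix (Fin p) (Fin m) ℝ)
    (hctrb : Controllable A B) (hobs : Observable C A) :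
    (∀ z : ℂ, (Matrix.charpoly (A.map (fun a => (a : ℂ)))).IsRoot z → z.re ≠ 0) ↔
    ((∀ ω : ℝ, IsUnit (((ω : ℂ) * Complex.I) • (1 : Matrix (Fin n) (Fin n) ℂ)
        - A.map (fun a => (a : ℂ)))) ∧
      ∃ M : ℝ, ∀ ω : ℝ,
        ‖C.map (fun a => (a : ℂ)) *
            (((ω : ℂ) * Complex.I) • (1 : Matrix (Fin n) (Fin n) ℂ)
              - A.map (fun a => (a : ℂ)))⁻¹ *
            B.map (fun a => (a : ℂ)) + D.map (fun a => (a : ℂ))‖ ≤ M) := by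
  constructor
  · intro h
    have hu : ∀ ω : ℝ, IsUnit (((ω : ℂ) * Complex.I) • (1 : Matrix (Fin n) (Fin n) ℂ)
        - A.map (fun a => (a : ℂ))) := by
      intro ω
      rw [Matrix.isUnit_iff_isUnit_det, isUnit_iff_ne_zero]
      intro h0
      refine h ((ω : ℂ) * Complex.I) ?_ (by simp)
      rw [Polynomial.IsRoot.def, Matrix.eval_charpoly, ← h0, Matrix.smul_one_eq_diagonal]
      rfl
    refine ⟨hu, ?_⟩
    have hc : Continuous fun ω : ℝ => ((ω : ℂ) * Complex.I) • (1 : Matrix (Fin n) (Fin n) ℂ)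
        - A.map (fun a => (a : ℂ)) := by fun_prop
    have hci := aux_inv_continuous _ hc hu
    have ht : Filter.Tendsto (fun ω : ℝ => (((ω : ℂ) * Complex.I) • (1 : Matrix (Fin n) (Fin n) ℂ)
        - A.map (fun a => (a : ℂ)))⁻¹) (Filter.cocompact ℝ) (nhds 0) := by
      have h1 : Filter.Tendsto (fun ω : ℝ => (ω : ℂ) * Complex.I) (Filter.cocompact ℝ)
          (Bornology.cobounded ℂ) := by
        rw [← tendsto_norm_atTop_iff_cobounded]
        refine (tendsto_norm_cocompact_atTop (E := ℝ)).congr fun ω => ?_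
        simp
      refine ((aux_resolvent_tendsto (A.map (fun a => (a : ℂ)))).comp h1).congr fun ω => ?_
      rw [Matrix.nonsing_inv_eq_ringInverse, Function.comp, resolvent,
        Algebra.algebraMap_eq_smul_one]
    have hG : Continuous fun X : Matrix (Fin n) (Fin n) ℂ =>
        ‖C.map (fun a => (a : ℂ)) * X * B.map (fun a => (a : ℂ))
          + D.map (fun a => (a : ℂ))‖ := by fun_prop
    have hF := hG.comp hci
    have hT := (hG.tendsto 0).comp ht
    have hev := hT.eventually (gt_mem_nhds (lt_add_one _))
    obtain ⟨K, hK, hKs⟩ := Filter.mem_cocompact.1 hev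
    obtain ⟨M, hM⟩ := hK.exists_bound_of_continuousOn hF.continuousOn
    refine ⟨max M (‖C.map (fun a => (a : ℂ)) * (0 : Matrix (Fin n) (Fin n) ℂ) * B.map (fun a => (a : ℂ))
          + D.map (fun a => (a : ℂ))‖ + 1), fun ω => ?_⟩
    by_cases hω : ω ∈ K
    · exact le_max_of_le_left ((le_abs_self _).trans (hM ω hω))
    · exact le_max_of_le_right (le_of_lt (hKs hω))
  · rintro ⟨hu, -⟩ z hz hre
    have h1 := hu z.im
    rw [Matrix.isUnit_iff_isUnit_det, isUnit_iff_ne_zero] at h1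
    apply h1
    have h2 : (z.im : ℂ) * Complex.I = z := by
      apply Complex.ext <;> simp [hre]
    rw [Polynomial.IsRoot.def, Matrix.eval_charpoly] at hz
    rw [h2, ← hz, Matrix.smul_one_eq_diagonal]
    rfl
end

section
/- Let A ∈ ℝ^{n×n}, B ∈ ℝ^{n×m}, C ∈ ℝ^{p×n}, let Q ∈ ℝ^{p×p} be symmetric positive semidefinite, R ∈ ℝ^{m×m} symmetric positive definite, and let S ∈ ℝ^{n×n} be a symmetric solution of the algebraic Riccati equation AᵀS + SA − SBR⁻¹BᵀS + CᵀQC = 0. Let u : (−∞,0] → ℝ^m be continuous, let x be differentiable with ẋ(t) = Ax(t) + Bu(t), x(0) = x₀, and x(t) → 0 as t → −∞, and set y(t) = Cx(t). If ∫_{−∞}^0 (y(t)ᵀQy(t) + u(t)ᵀRu(t)) dt converges, then ∫_{−∞}^0 (y(t)ᵀQy(t) + u(t)ᵀRu(t)) dt = −x₀ᵀS x₀ + ∫_{−∞}^0 (u(t) + R⁻¹BᵀS x(t))ᵀ R (u(t) + R⁻¹BᵀS x(t)) dt; in particular the backward-time infinite-horizon cost is at least −x₀ᵀS x₀ (applied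 with the negative-definite solution S₋, this gives the optimal backward cost −x₀ᵀS₋x₀). -/
open Matrix Set MeasureTheory

theorem aux_hasDerivAt {n : ℕ} (S : Matrix (Fin n) (Fin n) ℝ) (x : ℝ → Fin n → ℝ)
    (v : Fin n → ℝ) (t : ℝ) (hx : HasDerivAt x v t) :
    HasDerivAt (fun t => x t ⬝ᵥ S.mulVec (x t)) (v ⬝ᵥ S.mulVec (x t) + x t ⬝ᵥ S.mulVec v) t := by
  have h1 : HasDerivAt (fun t => S.mulVec (x t)) (S.mulVec v) t :=
    (LinearMap.toContinuousLinearMap S.mulVecLin).hasFDerivAt.comp_hasDerivAt t hx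
  have h2 := hasDerivAt_pi.1 hx
  have h3 := hasDerivAt_pi.1 h1
  have := HasDerivAt.fun_sum (u := Finset.univ) (fun i _ => (h2 i).mul (h3 i))
  simp only [dotProduct, ← Finset.sum_add_distrib]
  exact this

theorem aux_algebra {n m p : ℕ}
    (A : Matrix (Fin n) (Fin n) ℝ) (B : Matrix (Fin n) (Fin m) ℝ)
    (C : Matrix (Fin p) (Fin n) ℝ)
    (Q : Matrix (Fin p) (Fin p) ℝ) (R : Matrix (Fin m) (Fin m) ℝ)
    (hR : R.PosDef)
    (S : Matrix (Fin n) (Fin n) ℝ) (hSsymm : S.IsSymm)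
    (hS : Aᵀ * S + S * A - S * B * R⁻¹ * Bᵀ * S + Cᵀ * Q * C = 0)
    (x : Fin n → ℝ) (u : Fin m → ℝ) :
    (u + (R⁻¹ * Bᵀ * S).mulVec x) ⬝ᵥ R.mulVec (u + (R⁻¹ * Bᵀ * S).mulVec x) =
    ((A.mulVec x + B.mulVec u) ⬝ᵥ S.mulVec x + x ⬝ᵥ S.mulVec (A.mulVec x + B.mulVec u)) +
    ((C.mulVec x) ⬝ᵥ Q.mulVec (C.mulVec x) + u ⬝ᵥ R.mulVec u) := by
  have hdet : IsUnit R.det := hR.det_pos.ne'.isUnit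
  have hRt : Rᵀ = R := by
    have := hR.isHermitian.eq
    rwa [conjTranspose_eq_transpose_of_trivial] at this
  have hRK : R * (R⁻¹ * Bᵀ * S) = Bᵀ * S := by
    rw [Matrix.mul_assoc, Matrix.mul_nonsing_inv_cancel_left _ _ hdet]
  have hKt : (R⁻¹ * Bᵀ * S)ᵀ = S * B * R⁻¹ := by
    rw [transpose_mul, transpose_mul, transpose_nonsing_inv, hRt, hSsymm.eq, transpose_transpose,
      Matrix.mul_assoc]
  have hKR : (S * B * R⁻¹) * R = S * B := Matrix.nonsing_inv_mul_cancel_right _ _ hdet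
  have tr : ∀ {k l : ℕ} (M : Matrix (Fin k) (Fin l) ℝ) (a : Fin l → ℝ) (b : Fin k → ℝ),
      M.mulVec a ⬝ᵥ b = a ⬝ᵥ Mᵀ.mulVec b := by
    intro k l M a b
    rw [dotProduct_comm, dotProduct_mulVec, ← mulVec_transpose, dotProduct_comm]
  have h0 := congrArg (fun M => x ⬝ᵥ M.mulVec x) hS
  simp only [add_mulVec, sub_mulVec, dotProduct_add, dotProduct_sub, zero_mulVec,
    dotProduct_zero] at h0
  simp only [mulVec_add, dotProduct_add, add_dotProduct, tr, mulVec_mulVec, hRK, hKt, hKR,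
    ← Matrix.mul_assoc]
  linarith

/-- Completion-of-squares identity for the backward-time infinite-horizon LQ regulator:
if the symmetric `S` solves the algebraic Riccati equation, `ẋ = Ax + Bu` on `(-∞,0]`,
`x(0) = x₀`, `x(t) → 0` as `t → -∞`, `y = Cx`, and the cost integral converges, then
`∫_{-∞}^0 (yᵀQy + uᵀRu) dt = -x₀ᵀSx₀ + ∫_{-∞}^0 (u + R⁻¹BᵀSx)ᵀ R (u + R⁻¹BᵀSx) dt ≥ -x₀ᵀSx₀`. -/
theorem statement8 {n m p : ℕ}
    (A : Matrix (Fin n) (Fin n) ℝ) (B : Matrix (Fin n) (Fin m) ℝ)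
    (C : Matrix (Fin p) (Fin n) ℝ)
    (Q : Matrix (Fin p) (Fin p) ℝ) (R : Matrix (Fin m) (Fin m) ℝ)
    (hQ : Q.PosSemidef) (hR : R.PosDef)
    (S : Matrix (Fin n) (Fin n) ℝ) (hSsymm : S.IsSymm)
    (hS : Aᵀ * S + S * A - S * B * R⁻¹ * Bᵀ * S + Cᵀ * Q * C = 0)
    (x0 : Fin n → ℝ)
    (u : ℝ → Fin m → ℝ) (hu : ContinuousOn u (Iic (0:ℝ)))
    (x : ℝ → Fin n → ℝ)
    (hx : ∀ t ∈ Iic (0:ℝ), HasDerivAt x (A.mulVec (x t) + B.mulVec (u t)) t)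
    (hx0 : x 0 = x0)
    (hxlim : Filter.Tendsto x Filter.atBot (nhds 0))
    (hconv : IntegrableOn (fun t =>
      (C.mulVec (x t)) ⬝ᵥ Q.mulVec (C.mulVec (x t)) + u t ⬝ᵥ R.mulVec (u t)) (Iic (0:ℝ))) :
    ((∫ t in Iic (0:ℝ),
        ((C.mulVec (x t)) ⬝ᵥ Q.mulVec (C.mulVec (x t)) + u t ⬝ᵥ R.mulVec (u t)))
      = -(x0 ⬝ᵥ S.mulVec x0)
        + ∫ t in Iic (0:ℝ),
            ((u t + (R⁻¹ * Bᵀ * S).mulVec (x t)) ⬝ᵥ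
              R.mulVec (u t + (R⁻¹ * Bᵀ * S).mulVec (x t)))) ∧
    (-(x0 ⬝ᵥ S.mulVec x0)
      ≤ ∫ t in Iic (0:ℝ),
          ((C.mulVec (x t)) ⬝ᵥ Q.mulVec (C.mulVec (x t)) + u t ⬝ᵥ R.mulVec (u t))) := by
  have hder := fun t ht => aux_hasDerivAt S x _ t (hx t ht)
  have halg := fun t => aux_algebra A B C Q R hR S hSsymm hS (x t) (u t)
  set f : ℝ → ℝ := fun t =>
    (C.mulVec (x t)) ⬝ᵥ Q.mulVec (C.mulVec (x t)) + u t ⬝ᵥ R.mulVec (u t) with hf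
  set g : ℝ → ℝ := fun t => (u t + (R⁻¹ * Bᵀ * S).mulVec (x t)) ⬝ᵥ
    R.mulVec (u t + (R⁻¹ * Bᵀ * S).mulVec (x t)) with hg
  set V : ℝ → ℝ := fun t => x t ⬝ᵥ S.mulVec (x t) with hV
  have hder' : ∀ t ∈ Iic (0:ℝ), HasDerivAt V (g t - f t) t := by
    intro t ht
    have e : g t - f t = (A.mulVec (x t) + B.mulVec (u t)) ⬝ᵥ S.mulVec (x t) +
        x t ⬝ᵥ S.mulVec (A.mulVec (x t) + B.mulVec (u t)) := by
      have := halg t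
      simp only [hg, hf]
      linarith
    rw [e]
    exact hder t ht
  have hg0 : ∀ t, 0 ≤ g t := by
    intro t
    have := hR.posSemidef.dotProduct_mulVec_nonneg (u t + (R⁻¹ * Bᵀ * S).mulVec (x t))
    simpa [hg] using this
  have hxc : ContinuousOn x (Iic (0:ℝ)) := fun t ht => (hx t ht).continuousAt.continuousWithinAt
  have hquad : ∀ {k : ℕ} (M : Matrix (Fin k) (Fin k) ℝ),
      Continuous (fun w : Fin k → ℝ => w ⬝ᵥ M.mulVec w) := fun M => by fun_prop
  have hmv : ∀ {k l : ℕ} (M : Matrix (Fin k) (Fin l) ℝ),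
      Continuous (fun w : Fin l → ℝ => M.mulVec w) := fun M => by fun_prop
  have hgc : ContinuousOn g (Iic (0:ℝ)) :=
    (hquad R).comp_continuousOn (hu.add ((hmv _).comp_continuousOn hxc))
  have hVlim : Filter.Tendsto V Filter.atBot (nhds 0) := by
    have h : Filter.Tendsto V Filter.atBot (nhds ((0 : Fin n → ℝ) ⬝ᵥ S.mulVec 0)) :=
      ((hquad S).tendsto 0).comp hxlim
    rwa [zero_dotProduct] at h
  have hgint : ∀ a ≤ (0:ℝ), IntervalIntegrable g volume a 0 := by
    intro a ha
    apply ContinuousOn.intervalIntegrable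
    rw [uIcc_of_le ha]
    exact hgc.mono Icc_subset_Iic_self
  have hfint : ∀ a ≤ (0:ℝ), IntervalIntegrable f volume a 0 := by
    intro a ha
    rw [intervalIntegrable_iff_integrableOn_Ioc_of_le ha]
    exact hconv.mono_set Ioc_subset_Iic_self
  have hftc : ∀ a ≤ (0:ℝ), ∫ t in a..0, g t = V 0 - V a + ∫ t in a..0, f t := by
    intro a ha
    have := intervalIntegral.integral_eq_sub_of_hasDerivAt (a := a) (b := 0) (f := V)
      (f' := fun t => g t - f t)
      (fun t ht => hder' t (by rw [uIcc_of_le ha] at ht; exact ht.2))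
      ((hgint a ha).sub (hfint a ha))
    rw [intervalIntegral.integral_sub (hgint a ha) (hfint a ha)] at this
    linarith
  have hflim := intervalIntegral_tendsto_integral_Iic 0 hconv Filter.tendsto_id
  have hgI : IntegrableOn g (Iic (0:ℝ)) := by
    refine integrableOn_Iic_of_intervalIntegral_norm_tendsto (l := Filter.atBot) (a := id)
      (V 0 - 0 + ∫ t in Iic (0:ℝ), f t) 0 ?_ Filter.tendsto_id ?_
    · intro a
      by_cases ha : a ≤ 0
      · exact (intervalIntegrable_iff_integrableOn_Ioc_of_le ha).1 (hgint a ha)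
      · simp [Ioc_eq_empty (fun h : a < 0 => ha h.le)]
    · refine Filter.Tendsto.congr' ?_ ((tendsto_const_nhds.sub hVlim).add hflim)
      filter_upwards [Filter.eventually_le_atBot (0:ℝ)] with a ha
      simp only [Real.norm_of_nonneg (hg0 _), id]
      exact (hftc a ha).symm
  have hmain := integral_Iic_of_hasDerivAt_of_tendsto' (f := V) (f' := fun t => g t - f t)
    hder' (hgI.sub hconv) hVlim
  rw [integral_sub hgI hconv] at hmain
  have hV0 : V 0 = x0 ⬝ᵥ S.mulVec x0 := by simp [hV, hx0]
  have hgn : 0 ≤ ∫ t in Iic (0:ℝ), g t := integral_nonneg hg0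
  rw [hV0] at hmain
  constructor <;> linarith
end

section
/- Let τ ∈ ℝ with 0 ≤ τ < π/2. Then every s ∈ ℂ satisfying s + exp(−τ s) = 0 has Re s < 0. (Hence the delayed feedback loop ẋ(t) + x(t−τ) = 0, whose characteristic function is s + e^{−sτ}, is f-stable for such τ.) -/
/-- For a delay `0 ≤ τ < π/2`, every zero of the characteristic function `s + e^{-τs}` of the
delayed feedback loop `ẋ(t) + x(t-τ) = 0` lies in the open left half-plane, i.e. the loop is
f-stable. -/
theorem statement10 (τ : ℝ) (h0 : 0 ≤ τ) (hπ : τ < Real.pi / 2) :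
    ∀ s : ℂ, s + Complex.exp (-(τ : ℂ) * s) = 0 → s.re < 0 := by
  intro s hs
  by_contra hx
  have hx : 0 ≤ s.re := not_lt.mp hx
  have hre := congrArg Complex.re hs
  have him := congrArg Complex.im hs
  simp [Complex.exp_re, Complex.exp_im] at hre him
  have hE : Real.exp (-(τ * s.re)) ≤ 1 := by
    rw [Real.exp_le_one_iff]
    have := mul_nonneg h0 hx
    linarith
  have hE0 := Real.exp_pos (-(τ * s.re))
  have hy : |s.im| ≤ 1 := by
    have h1 : s.im = Real.exp (-(τ * s.re)) * Real.sin (τ * s.im) := by linarith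
    rw [h1, abs_mul, abs_of_pos hE0]
    exact mul_le_one₀ hE (abs_nonneg _) (Real.abs_sin_le_one _)
  obtain ⟨hy1, hy2⟩ := abs_le.mp hy
  have hc : 0 < Real.cos (τ * s.im) := by
    apply Real.cos_pos_of_mem_Ioo
    constructor <;> nlinarith
  have := mul_pos hE0 hc
  linarith
end

section
/- Let τ > 0. Then the set {s ∈ ℂ : Re s > 0 and s + exp(τ s) = 0} is infinite. (Hence the feedback loop consisting of an integrator in series with an ideal predictor of lead τ and negative unity feedback, whose characteristic function is s + e^{τ s}, has infinitely many characteristic roots in the open right half-plane and fails to be f-stable.) -/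
theorem statement11_aux (τ : ℝ) (hτ : 0 < τ) (n : ℕ) (hn : τ < n) :
    ∃ s : ℂ, (0 < s.re ∧ s + Complex.exp ((τ : ℂ) * s) = 0) ∧ n / τ < s.im := by
  have hpi := Real.pi_gt_three
  obtain ⟨c, hc⟩ : ∃ c : ℝ, c = Real.pi + n * (2 * Real.pi) := ⟨_, rfl⟩
  have hn0 : (0 : ℝ) < n := hτ.trans hn
  have hcn : (n : ℝ) < c := by rw [hc]; nlinarith
  have hc0 : 0 < c := hn0.trans hcn
  have hcont : ContinuousOn (fun φ : ℝ => Real.sin φ * Real.log ((φ + c) / τ)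
      + Real.negMulLog (Real.sin φ) - (φ + c) * Real.cos φ) (Set.Icc 0 (Real.pi / 2)) := by
    apply ContinuousOn.sub
    · apply ContinuousOn.add
      · apply ContinuousOn.mul Real.continuous_sin.continuousOn
        apply ContinuousOn.log (by fun_prop)
        intro x hx
        have : 0 < x + c := by linarith [hx.1]
        positivity
      · exact (Real.continuous_negMulLog.comp Real.continuous_sin).continuousOn
    · fun_prop
  have hlog : 0 < Real.log ((Real.pi / 2 + c) / τ) := by
    apply Real.log_pos
    rw [lt_div_iff₀ hτ]; linarith
  obtain ⟨φ, ⟨h0, h1⟩, hφ⟩ := intermediate_value_Ioo (by positivity) hcont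
    (show (0 : ℝ) ∈ _ by
      constructor
      · simp; exact hc0
      · simpa using hlog)
  have hs : 0 < Real.sin φ := Real.sin_pos_of_pos_of_lt_pi h0 (by linarith)
  have hco : 0 < Real.cos φ := Real.cos_pos_of_mem_Ioo ⟨by linarith, h1⟩
  have hy : 0 < φ + c := by linarith
  have hexp : Real.exp ((φ + c) * Real.cos φ / Real.sin φ) = (φ + c) / τ / Real.sin φ := by
    rw [← Real.exp_log (show 0 < (φ + c) / τ / Real.sin φ by positivity),
      Real.log_div (by positivity) hs.ne']
    congr 1
    simp only [Real.negMulLog] at hφ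
    field_simp
    linarith
  have hsin : Real.sin (φ + c) = - Real.sin φ := by
    rw [hc, ← add_assoc, Real.sin_add_nat_mul_two_pi, Real.sin_add_pi]
  have hcos : Real.cos (φ + c) = - Real.cos φ := by
    rw [hc, ← add_assoc, Real.cos_add_nat_mul_two_pi, Real.cos_add_pi]
  have e1 : τ * ((φ + c) / τ * (Real.cos φ / Real.sin φ)) = (φ + c) * Real.cos φ / Real.sin φ := by
    field_simp
  have e2 : τ * ((φ + c) / τ) = φ + c := by field_simp
  refine ⟨⟨(φ + c) / τ * (Real.cos φ / Real.sin φ), (φ + c) / τ⟩, ⟨by positivity, ?_⟩, ?_⟩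
  · apply Complex.ext
    · rw [Complex.add_re, Complex.exp_re, Complex.re_ofReal_mul, Complex.im_ofReal_mul]
      simp only [e1, e2, hexp, hcos, Complex.zero_re]
      ring
    · rw [Complex.add_im, Complex.exp_im, Complex.re_ofReal_mul, Complex.im_ofReal_mul]
      simp only [e1, e2, hexp, hsin, Complex.zero_im]
      field_simp
      ring
  · show n / τ < (φ + c) / τ
    gcongr
    linarith

/-- For any predictor lead `τ > 0`, the characteristic function `s + e^{τs}` of the feedback
loop consisting of an integrator in series with an ideal predictor and negative unity feedback
has infinitely many zeros in the open right half-plane; hence the loop fails to be f-stable. -/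
theorem statement11 (τ : ℝ) (hτ : 0 < τ) :
    {s : ℂ | 0 < s.re ∧ s + Complex.exp ((τ : ℂ) * s) = 0}.Infinite := by
  apply Set.Infinite.of_image Complex.im
  apply Set.infinite_of_forall_exists_gt
  intro a
  obtain ⟨n, hn⟩ := exists_nat_gt (max τ (a * τ))
  obtain ⟨s, hs, h⟩ := statement11_aux τ hτ n ((le_max_left _ _).trans_lt hn)
  refine ⟨s.im, ⟨s, hs, rfl⟩, lt_trans ?_ h⟩
  rw [lt_div_iff₀ hτ]
  exact (le_max_right _ _).trans_lt hn
end

section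
/- Define G₁ = {(u,y) ∈ L²(ℝ;ℝ) × L²(ℝ;ℝ) : for almost every t the integral ∫_{−∞}^t e^{t−τ}u(τ)dτ converges absolutely and y(t) = ∫_{−∞}^t e^{t−τ}u(τ)dτ} (the graph of the causal unstable convolution system P₁) and G₂ = {(u,y) ∈ L²(ℝ;ℝ) × L²(ℝ;ℝ) : y(t) = −∫_t^∞ e^{t−τ}u(τ)dτ for almost every t} (the graph of the anticausal stable convolution system P₂). Then the closure of G₁ in L²(ℝ;ℝ) × L²(ℝ;ℝ) equals G₂, and G₁ is a proper subset of G₂; in particular G₁ is not closed. -/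
open MeasureTheory Set

/-- The graph of the causal unstable convolution system `P₁` (kernel `e^t` for `t ≥ 0`),
as a set of input–output pairs in `L²(ℝ) × L²(ℝ)`. -/
def graphP1 : Set (Lp ℝ 2 (volume : Measure ℝ) × Lp ℝ 2 (volume : Measure ℝ)) :=
  {q | ∀ᵐ t : ℝ, IntegrableOn (fun τ => Real.exp (t - τ) * (q.1 : ℝ → ℝ) τ) (Iic t) ∧
    (q.2 : ℝ → ℝ) t = ∫ τ in Iic t, Real.exp (t - τ) * (q.1 : ℝ → ℝ) τ}

/-- The graph of the anticausal stable convolution system `P₂` (kernel `-e^t` for `t ≤ 0`),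
as a set of input–output pairs in `L²(ℝ) × L²(ℝ)`. -/
def graphP2 : Set (Lp ℝ 2 (volume : Measure ℝ) × Lp ℝ 2 (volume : Measure ℝ)) :=
  {q | ∀ᵐ t : ℝ, (q.2 : ℝ → ℝ) t = -∫ τ in Ici t, Real.exp (t - τ) * (q.1 : ℝ → ℝ) τ}

open Filter Topology

lemma aux_exp_two (c : ℝ) (hc : 0 < c) (T t : ℝ) :
    IntegrableOn (fun τ => Real.exp (c * (τ - T))) (Iic t) ∧
      ∫ τ in Iic t, Real.exp (c * (τ - T)) = Real.exp (c * (t - T)) / c := by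
  have h : (fun τ => Real.exp (c * (τ - T))) = fun τ => Real.exp (-(c * T)) * Real.exp (c * τ) := by
    funext τ; rw [← Real.exp_add]; ring_nf
  rw [h]
  refine ⟨(integrableOn_exp_mul_Iic hc t).const_mul _, ?_⟩
  rw [integral_const_mul, integral_exp_mul_Iic hc, mul_div_assoc', ← Real.exp_add]
  ring_nf

/-- Square of the anticausal kernel. -/
lemma aux_ker_sq (t : ℝ) :
    IntegrableOn (fun τ => Real.exp (t - τ) ^ 2) (Ici t) ∧
      ∫ τ in Ici t, Real.exp (t - τ) ^ 2 = 1 / 2 := by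
  have h : (fun τ => Real.exp (t - τ) ^ 2) =
      fun τ => Real.exp (2 * t) * Real.exp ((-2) * τ) := by
    funext τ; rw [← Real.exp_add, ← Real.exp_nat_mul]; push_cast; ring_nf
  rw [h]
  constructor
  · rw [integrableOn_Ici_iff_integrableOn_Ioi]
    exact (integrableOn_exp_mul_Ioi (by norm_num) t).const_mul _
  · rw [integral_Ici_eq_integral_Ioi, integral_const_mul, integral_exp_mul_Ioi (by norm_num),
      mul_div_assoc', mul_neg, ← Real.exp_add]
    ring_nf; simp

lemma aux_ker_memLp (t : ℝ) :
    MemLp (fun τ => Real.exp (t - τ)) 2 (volume.restrict (Ici t)) := by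
  rw [memLp_two_iff_integrable_sq (by fun_prop)]
  exact (aux_ker_sq t).1

lemma aux_int_Ici {u : ℝ → ℝ} (hu : MemLp u 2 volume) (s t : ℝ) :
    IntegrableOn (fun τ => Real.exp (s - τ) * u τ) (Ici t) := by
  have h : (fun τ => Real.exp (s - τ) * u τ) =
      fun τ => Real.exp (s - t) * (Real.exp (t - τ) * u τ) := by
    funext τ; rw [← mul_assoc, ← Real.exp_add]; ring_nf
  rw [h]
  exact ((aux_ker_memLp t).integrable_mul (hu.restrict _)).const_mul _

lemma aux_bound {u : ℝ → ℝ} (hu : MemLp u 2 volume) (t : ℝ) :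
    |∫ τ in Ici t, Real.exp (t - τ) * u τ| ≤ 1 / 2 + ∫ τ, u τ ^ 2 := by
  have h2 : ∫ τ in Ici t, u τ ^ 2 ≤ ∫ τ, u τ ^ 2 :=
    setIntegral_le_integral hu.integrable_sq (ae_of_all _ fun x => sq_nonneg _)
  calc |∫ τ in Ici t, Real.exp (t - τ) * u τ|
      ≤ ∫ τ in Ici t, |Real.exp (t - τ) * u τ| := abs_integral_le_integral_abs
    _ ≤ ∫ τ in Ici t, (Real.exp (t - τ) ^ 2 + u τ ^ 2) := by
        refine integral_mono (aux_int_Ici hu t t).abs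
          ((aux_ker_sq t).1.add hu.integrable_sq.integrableOn) fun τ => ?_
        simp only [abs_le]
        constructor <;> nlinarith [sq_nonneg (Real.exp (t - τ) - u τ),
          sq_nonneg (Real.exp (t - τ) + u τ), sq_nonneg (u τ), sq_nonneg (Real.exp (t - τ))]
    _ = 1 / 2 + ∫ τ in Ici t, u τ ^ 2 := by
        rw [integral_add (aux_ker_sq t).1 hu.integrable_sq.integrableOn, (aux_ker_sq t).2]
    _ ≤ _ := by linarith

lemma aux_shift (u : ℝ → ℝ) (s t : ℝ) (S : Set ℝ) :
    ∫ τ in S, Real.exp (s - τ) * u τ =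
      Real.exp (s - t) * ∫ τ in S, Real.exp (t - τ) * u τ := by
  rw [← integral_const_mul]
  congr 1; funext τ; rw [← mul_assoc, ← Real.exp_add]; ring_nf

lemma aux_small {y : ℝ → ℝ} (hy : MemLp y 2 volume) {δ : ℝ} (hδ : 0 < δ) :
    volume {x | δ ≤ |y x|} < ⊤ := by
  have := hy.meas_ge_lt_top (by norm_num) (by norm_num) (ε := ⟨δ, hδ.le⟩)
    (by intro h; exact hδ.ne' (congrArg NNReal.toReal h))
  exact this

lemma aux_sub : graphP1 ⊆ graphP2 := by
  rintro ⟨u, y⟩ h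
  simp only [graphP1, graphP2, mem_ofPred_eq] at h ⊢
  have hu := Lp.memLp u
  obtain ⟨t0, ht0, -⟩ := h.exists
  have hI : ∀ s, Integrable (fun τ => Real.exp (s - τ) * u τ) := by
    intro s
    have h0 : Integrable (fun τ => Real.exp (t0 - τ) * u τ) := by
      rw [← integrableOn_univ, ← Iic_union_Ici (a := t0)]
      exact ht0.union (aux_int_Ici hu t0 t0)
    have he : (fun τ => Real.exp (s - τ) * u τ) =
        fun τ => Real.exp (s - t0) * (Real.exp (t0 - τ) * u τ) := by
      funext τ; rw [← mul_assoc, ← Real.exp_add]; ring_nf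
    rw [he]; exact h0.const_mul _
  set c := ∫ τ, Real.exp (0 - τ) * u τ with hc
  have key : ∀ t, ∫ τ in Iic t, Real.exp (t - τ) * u τ =
      Real.exp t * c - ∫ τ in Ici t, Real.exp (t - τ) * u τ := by
    intro t
    have h1 := intervalIntegral.integral_Iic_add_Ioi (b := t) (hI t).integrableOn
      (hI t).integrableOn
    rw [← integral_Ici_eq_integral_Ioi] at h1
    have h2 := aux_shift u t 0 univ
    simp only [Measure.restrict_univ, sub_zero t] at h2
    rw [hc, ← h2]; linarith
  have hc0 : c = 0 := by
    by_contra hne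
    set B := 1 / 2 + ∫ τ, u τ ^ 2
    have hB : 0 ≤ B := by
      have : 0 ≤ ∫ τ, u τ ^ 2 := integral_nonneg fun x => sq_nonneg _
      simp only [B]; linarith
    have hcp : 0 < |c| := abs_pos.2 hne
    have hfin := aux_small (Lp.memLp y) one_pos
    have hle : volume (Ici ((B + 1) / |c|)) ≤ volume {x | 1 ≤ |y x|} := by
      refine measure_mono_ae ?_
      filter_upwards [h] with t ht htm
      have htm' : (B + 1) / |c| ≤ t := htm
      change 1 ≤ |y t|
      rw [ht.2, key]
      have hb : _ ≤ B := aux_bound hu t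
      have h1 : B + 1 ≤ Real.exp t * |c| := by
        rw [div_le_iff₀ hcp] at htm'
        have := Real.add_one_le_exp t
        nlinarith
      have h2 : Real.exp t * |c| = |Real.exp t * c| := by
        rw [abs_mul, abs_of_pos (Real.exp_pos t)]
      have h3 := abs_sub_abs_le_abs_sub (Real.exp t * c) (∫ τ in Ici t, Real.exp (t - τ) * u τ)
      linarith
    rw [Real.volume_Ici] at hle
    exact absurd hfin (not_lt.2 hle)
  filter_upwards [h] with t ht
  rw [ht.2, key, hc0]; ring

lemma aux_closed : IsClosed graphP2 := by
  refine isClosed_of_closure_subset fun q hq => ?_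
  obtain ⟨x, hx, hlim⟩ := mem_closure_iff_seq_limit.1 hq
  have h1 : Tendsto (fun n => (x n).1) atTop (𝓝 q.1) := (continuous_fst.tendsto q).comp hlim
  have h2 : Tendsto (fun n => (x n).2) atTop (𝓝 q.2) := (continuous_snd.tendsto q).comp hlim
  obtain ⟨ns, hns, hae⟩ := (tendstoInMeasure_of_tendsto_Lp h2).exists_seq_tendsto_ae
  have hx' : ∀ᵐ t : ℝ, ∀ n, ((x n).2 : ℝ → ℝ) t =
      -∫ τ in Ici t, Real.exp (t - τ) * ((x n).1 : ℝ → ℝ) τ := ae_all_iff.2 fun n => hx n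
  have hcont : ∀ t : ℝ, Tendsto
      (fun n => ∫ τ in Ici t, Real.exp (t - τ) * ((x n).1 : ℝ → ℝ) τ) atTop
      (𝓝 (∫ τ in Ici t, Real.exp (t - τ) * (q.1 : ℝ → ℝ) τ)) := by
    intro t
    have hm : MemLp ((Ici t).indicator fun τ => Real.exp (t - τ)) 2 volume :=
      (memLp_indicator_iff_restrict measurableSet_Ici).2 (aux_ker_memLp t)
    have he : ∀ f : Lp ℝ 2 (volume : Measure ℝ),
        ∫ τ in Ici t, Real.exp (t - τ) * (f : ℝ → ℝ) τ = inner ℝ hm.toLp f := by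
      intro f
      rw [L2.inner_def, ← integral_indicator measurableSet_Ici]
      refine integral_congr_ae ?_
      filter_upwards [hm.coeFn_toLp] with τ hτ
      rw [hτ]
      by_cases h : τ ∈ Ici t <;> simp [h, mul_comm]
    simp only [he]
    exact tendsto_const_nhds.inner h1
  simp only [graphP2, mem_ofPred_eq]
  filter_upwards [hae, hx'] with t ht hxt
  refine tendsto_nhds_unique ht ?_
  simp only [hxt]
  exact ((hcont t).comp hns.tendsto_atTop).neg

/-- Replace the far past by an exponential. -/
noncomputable def auxMod (f : ℝ → ℝ) (a T : ℝ) : ℝ → ℝ :=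
  (Iic T).piecewise (fun t => a * Real.exp (2 * (t - T))) f

lemma aux_exp_memLp (a T : ℝ) :
    MemLp (fun t => a * Real.exp (2 * (t - T))) 2 (volume.restrict (Iic T)) := by
  refine MemLp.const_mul ?_ a
  rw [memLp_two_iff_integrable_sq (by fun_prop)]
  refine (integrable_congr (ae_of_all _ fun τ => ?_)).2 (aux_exp_two 4 (by norm_num) T T).1
  beta_reduce
  rw [← Real.exp_nat_mul]; push_cast; ring_nf

lemma auxMod_memLp {f : ℝ → ℝ} (hf : MemLp f 2 volume) (a T : ℝ) :
    MemLp (auxMod f a T) 2 volume :=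
  MemLp.piecewise measurableSet_Iic (aux_exp_memLp a T) (hf.restrict _)

lemma auxMod_dist (f : Lp ℝ 2 (volume : Measure ℝ)) (a T : ℝ) :
    dist f (auxMod_memLp (Lp.memLp f) a T).toLp ^ 2 ≤
      2 * (∫ τ in Iic T, (f : ℝ → ℝ) τ ^ 2) + a ^ 2 / 2 := by
  set g := (auxMod_memLp (Lp.memLp f) a T).toLp with hg
  have hf := Lp.memLp f
  rw [dist_eq_norm, ← real_inner_self_eq_norm_sq, L2.inner_def]
  have hE := aux_exp_two 4 (by norm_num) T T
  have h1 : ∫ τ, inner ℝ ((f - g : Lp ℝ 2 (volume : Measure ℝ)) τ) ((f - g : Lp ℝ 2 (volume : Measure ℝ)) τ) =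
      ∫ τ in Iic T, ((f : ℝ → ℝ) τ - a * Real.exp (2 * (τ - T))) ^ 2 := by
    rw [← integral_indicator measurableSet_Iic]
    refine integral_congr_ae ?_
    filter_upwards [Lp.coeFn_sub f g, (auxMod_memLp hf a T).coeFn_toLp] with τ h1 h2
    rw [h1, Pi.sub_apply, hg, h2]
    by_cases h : τ ∈ Iic T
    · simp [auxMod, h, sq]
    · simp [auxMod, h]
  rw [h1]
  have hi1 : IntegrableOn (fun τ => 2 * (f : ℝ → ℝ) τ ^ 2) (Iic T) :=
    (hf.integrable_sq.const_mul 2).integrableOn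
  have hi2 : IntegrableOn (fun τ => 2 * a ^ 2 * Real.exp (4 * (τ - T))) (Iic T) :=
    hE.1.const_mul _
  calc _ ≤ ∫ τ in Iic T, (2 * (f : ℝ → ℝ) τ ^ 2 + 2 * a ^ 2 * Real.exp (4 * (τ - T))) := by
        refine integral_mono ((hf.restrict _).sub (aux_exp_memLp a T)).integrable_sq
          (hi1.add hi2) fun τ => ?_
        have : Real.exp (4 * (τ - T)) = Real.exp (2 * (τ - T)) ^ 2 := by
          rw [← Real.exp_nat_mul]; push_cast; ring_nf
        simp only [this]
        nlinarith [sq_nonneg ((f : ℝ → ℝ) τ + a * Real.exp (2 * (τ - T)))]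
    _ = _ := by
        rw [integral_add hi1 hi2, integral_const_mul, integral_const_mul, hE.2]
        simp; ring

lemma auxMod_mem (u y : Lp ℝ 2 (volume : Measure ℝ)) (h : (u, y) ∈ graphP2) (a T : ℝ)
    (ha : a = -∫ τ in Ici T, Real.exp (T - τ) * (u : ℝ → ℝ) τ) :
    ((auxMod_memLp (Lp.memLp u) a T).toLp, (auxMod_memLp (Lp.memLp y) a T).toLp) ∈ graphP1 := by
  have hu := Lp.memLp u
  simp only [graphP1, graphP2, mem_ofPred_eq] at h ⊢
  have hcu : ∀ t : ℝ, (fun τ => Real.exp (t - τ) * ((auxMod_memLp hu a T).toLp : ℝ → ℝ) τ) =ᵐ[volume]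
      fun τ => Real.exp (t - τ) * auxMod u a T τ := by
    intro t
    filter_upwards [(auxMod_memLp hu a T).coeFn_toLp] with τ hτ
    rw [hτ]
  -- values on the left
  have hleft : ∀ s t : ℝ, s ≤ T → IntegrableOn (fun τ => Real.exp (t - τ) * auxMod u a T τ) (Iic s) ∧
      ∫ τ in Iic s, Real.exp (t - τ) * auxMod u a T τ =
        a * Real.exp (t - T) * Real.exp (s - T) := by
    intro s t hs
    have hE := aux_exp_two 1 one_pos T s
    have he : EqOn (fun τ => a * Real.exp (t - T) * Real.exp (1 * (τ - T)))
        (fun τ => Real.exp (t - τ) * auxMod u a T τ) (Iic s) := by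
      intro τ hτ
      have : τ ∈ Iic T := le_trans hτ hs
      simp only [auxMod, piecewise_eq_of_mem _ _ _ this]
      have : Real.exp (t - T) * Real.exp (1 * (τ - T)) =
        Real.exp (t - τ) * Real.exp (2 * (τ - T)) := by
        rw [← Real.exp_add, ← Real.exp_add]; ring_nf
      linear_combination a * this
    refine ⟨IntegrableOn.congr_fun (hE.1.const_mul _) he measurableSet_Iic, ?_⟩
    rw [← setIntegral_congr_fun measurableSet_Iic he, integral_const_mul, hE.2]
    simp
  filter_upwards [h, (auxMod_memLp (Lp.memLp y) a T).coeFn_toLp] with t ht hyt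
  rw [integral_congr_ae (ae_restrict_of_ae (hcu t)), hyt,
    integrableOn_congr_fun_ae (ae_restrict_of_ae (hcu t))]
  rcases le_or_gt t T with htT | htT
  · refine ⟨(hleft t t htT).1, ?_⟩
    rw [(hleft t t htT).2]
    have : t ∈ Iic T := htT
    simp only [auxMod, piecewise_eq_of_mem _ _ _ this]
    rw [mul_assoc, ← Real.exp_add]; ring_nf
  · have hT := hleft T t le_rfl
    have he : EqOn (fun τ => Real.exp (t - τ) * u τ)
        (fun τ => Real.exp (t - τ) * auxMod u a T τ) (Ioc T t) := by
      intro τ hτ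
      have : τ ∉ Iic T := not_le.2 hτ.1
      simp only [auxMod, piecewise_eq_of_notMem _ _ _ this]
    have hi0 : IntegrableOn (fun τ => Real.exp (t - τ) * u τ) (Ioc T t) :=
      (aux_int_Ici hu t T).mono_set fun τ hτ => hτ.1.le
    have hi : IntegrableOn (fun τ => Real.exp (t - τ) * auxMod u a T τ) (Ioc T t) :=
      hi0.congr_fun he measurableSet_Ioc
    have hun : Iic T ∪ Ioc T t = Iic t := Iic_union_Ioc_eq_Iic htT.le
    have hdj : Disjoint (Iic T) (Ioc T t) := by
      rw [Set.disjoint_left]; intro x hx hx2; exact absurd hx2.1 (not_lt.2 hx)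
    refine ⟨hun ▸ hT.1.union hi, ?_⟩
    rw [← hun, setIntegral_union hdj measurableSet_Ioc hT.1 hi, hT.2,
      ← setIntegral_congr_fun measurableSet_Ioc he]
    have : t ∉ Iic T := not_le.2 htT
    simp only [auxMod, piecewise_eq_of_notMem _ _ _ this]
    rw [ht]
    have h3 : ∫ τ in Ioi T, Real.exp (t - τ) * u τ = (∫ τ in Ioc T t, Real.exp (t - τ) * u τ) +
        ∫ τ in Ioi t, Real.exp (t - τ) * u τ := by
      rw [← setIntegral_union _ measurableSet_Ioi hi0
        ((aux_int_Ici hu t t).mono_set Ioi_subset_Ici_self), Ioc_union_Ioi_eq_Ioi htT.le]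
      rw [Set.disjoint_left]; intro x hx hx2; exact absurd hx2 (not_lt.2 hx.2)
    rw [← integral_Ici_eq_integral_Ioi, ← integral_Ici_eq_integral_Ioi, aux_shift u t T] at h3
    rw [sub_self, Real.exp_zero, ha]
    linarith

lemma aux_tail (f : Lp ℝ 2 (volume : Measure ℝ)) {δ : ℝ} (hδ : 0 < δ) :
    ∀ᶠ T : ℝ in atBot, ∫ τ in Iic T, (f : ℝ → ℝ) τ ^ 2 < δ := by
  have := tendsto_integral_Iic_zero (μ := volume) (f := fun τ => (f : ℝ → ℝ) τ ^ 2)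
    (tendsto_id (α := ℝ) (x := atBot))
  exact this.eventually_lt_const hδ

lemma aux_dense : graphP2 ⊆ closure graphP1 := by
  rintro ⟨u, y⟩ h
  rw [Metric.mem_closure_iff]
  intro ε hε
  have hε2 : 0 < ε ^ 2 / 4 := by positivity
  obtain ⟨T0, hT0⟩ := eventually_atBot.1 ((aux_tail u hε2).and (aux_tail y hε2))
  have hex : ∃ T ≤ T0, |-∫ τ in Ici T, Real.exp (T - τ) * (u : ℝ → ℝ) τ| < ε / 2 := by
    by_contra! hcon
    have hfin := aux_small (Lp.memLp y) (half_pos hε)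
    have hle : volume (Iic T0) ≤ volume {x | ε / 2 ≤ |y x|} := by
      refine measure_mono_ae ?_
      filter_upwards [h] with t ht htm
      change ε / 2 ≤ |y t|
      have ht' : y t = -∫ τ in Ici t, Real.exp (t - τ) * (u : ℝ → ℝ) τ := ht
      rw [ht']
      exact hcon t htm
    rw [Real.volume_Iic] at hle
    exact absurd hfin (not_lt.2 hle)
  obtain ⟨T, hT, hTa⟩ := hex
  generalize haa : (-∫ τ in Ici T, Real.exp (T - τ) * (u : ℝ → ℝ) τ) = a at hTa
  refine ⟨_, auxMod_mem u y h a T haa.symm, ?_⟩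
  have ha2 : a ^ 2 < (ε / 2) ^ 2 := by
    rw [← sq_abs]; exact pow_lt_pow_left₀ hTa (abs_nonneg _) two_ne_zero
  have h1 := auxMod_dist u a T
  have h2 := auxMod_dist y a T
  have h3 := hT0 T hT
  rw [Prod.dist_eq, max_lt_iff]
  constructor
  · refine lt_of_pow_lt_pow_left₀ 2 hε.le (lt_of_le_of_lt h1 ?_)
    nlinarith [h3.1]
  · refine lt_of_pow_lt_pow_left₀ 2 hε.le (lt_of_le_of_lt h2 ?_)
    nlinarith [h3.2]

lemma aux_ne : ∃ q ∈ graphP2, q ∉ graphP1 := by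
  have hu : MemLp ((Iic (0:ℝ)).indicator fun t => 1 * Real.exp (2 * (t - 0))) 2 volume :=
    (memLp_indicator_iff_restrict measurableSet_Iic).2 (aux_exp_memLp 1 0)
  have hy : MemLp ((Iic (0:ℝ)).indicator fun t => Real.exp (2 * t) - Real.exp t) 2 volume := by
    refine (memLp_indicator_iff_restrict measurableSet_Iic).2 (MemLp.sub ?_ ?_)
    · simpa using aux_exp_memLp 1 0
    · rw [memLp_two_iff_integrable_sq (by fun_prop)]
      refine (integrable_congr (ae_of_all _ fun τ => ?_)).2 (aux_exp_two 2 (by norm_num) 0 0).1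
      beta_reduce
      rw [← Real.exp_nat_mul]; push_cast; ring_nf
  have hcu : ∀ t : ℝ, (fun τ => Real.exp (t - τ) * (hu.toLp : ℝ → ℝ) τ) =ᵐ[volume]
      (Iic (0:ℝ)).indicator fun τ => Real.exp t * Real.exp τ := by
    intro t
    filter_upwards [hu.coeFn_toLp] with τ hτ
    rw [hτ]
    by_cases hm : τ ∈ Iic (0:ℝ)
    · simp only [indicator_of_mem hm, one_mul, ← Real.exp_add]; ring_nf
    · simp [indicator_of_notMem hm]
  refine ⟨(hu.toLp, hy.toLp), ?_, ?_⟩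
  · simp only [graphP2, mem_ofPred_eq]
    filter_upwards [hy.coeFn_toLp] with t ht
    rw [ht, integral_congr_ae (ae_restrict_of_ae (hcu t)), setIntegral_indicator measurableSet_Iic,
      Ici_inter_Iic]
    rcases le_or_gt t 0 with h | h
    · have hm : t ∈ Iic (0:ℝ) := h
      rw [indicator_of_mem hm, integral_Icc_eq_integral_Ioc, ← intervalIntegral.integral_of_le h,
        intervalIntegral.integral_const_mul, integral_exp, Real.exp_zero, two_mul, Real.exp_add]
      ring
    · have hm : t ∉ Iic (0:ℝ) := not_le.2 h
      rw [indicator_of_notMem hm, Icc_eq_empty (not_le.2 h)]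
      simp
  · intro h
    simp only [graphP1, mem_ofPred_eq] at h
    have hpos : ∃ t : ℝ, 0 < t ∧ (hy.toLp : ℝ → ℝ) t = 0 ∧ (hy.toLp : ℝ → ℝ) t =
        ∫ τ in Iic t, Real.exp (t - τ) * (hu.toLp : ℝ → ℝ) τ := by
      by_contra! hcon
      have : volume (Ioi (0:ℝ)) ≤ volume (∅ : Set ℝ) := by
        refine measure_mono_ae ?_
        filter_upwards [h, hy.coeFn_toLp] with t h1 h2 htm
        have htm' : 0 < t := htm
        have hm : t ∉ Iic (0:ℝ) := not_le.2 htm'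
        rw [indicator_of_notMem hm] at h2
        exact absurd h1.2 (hcon t htm' h2)
      simp at this
    obtain ⟨t, ht, h0, h1⟩ := hpos
    rw [h0, integral_congr_ae (ae_restrict_of_ae (hcu t)), setIntegral_indicator measurableSet_Iic,
      Iic_inter_Iic, min_eq_right ht.le, integral_const_mul, integral_exp_Iic_zero, mul_one] at h1
    exact (Real.exp_pos t).ne h1

/-- On the doubly-infinite time axis, the closure of the graph of the causal unstable system
`P₁` equals the graph of the anticausal stable system `P₂`, and the former is a proper subset
of the latter; in particular the graph of `P₁` is not closed. -/
theorem statement15 :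
    closure graphP1 = graphP2 ∧ graphP1 ⊂ graphP2 ∧ ¬IsClosed graphP1 := by
  have hcl : closure graphP1 = graphP2 :=
    Subset.antisymm (closure_minimal aux_sub aux_closed) aux_dense
  obtain ⟨q, hq2, hq1⟩ := aux_ne
  refine ⟨hcl, ⟨aux_sub, fun h => hq1 (h hq2)⟩, fun h => hq1 ?_⟩
  rw [← h.closure_eq, hcl]
  exact hq2
end
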